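/- For any point placement P of n points, the sum over all 3-element subsets T of P of the number of 2-element subsets {x, y} ⊆ P \ T such that x and y are both γ-points of T lying in the same region with respect to T equals 5·P₅(P) + 2·U(P). -/

import Mathlib

open Finset

/-- A finite set of points in the plane is in *general position* if no three of
its points are collinear. -/
def GenPos (P : Finset (ℝ × ℝ)) : Prop :=
  ∀ x ∈ P, ∀ y ∈ P, ∀ z ∈ P, x ≠ y → x ≠ z → y ≠ z →
    ¬ Collinear ℝ ({x, y, z} : Set (ℝ × ℝ))

/-- A finite set of points is in *convex position* if every point of it is an
extreme point of its convex hull. -/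
def ConvexPos (S : Finset (ℝ × ℝ)) : Prop :=
  ∀ x ∈ S, x ∈ Set.extremePoints ℝ (convexHull ℝ (S : Set (ℝ × ℝ)))

open scoped Classical in
/-- Number of `k`-element subsets of `P` that are in convex position. -/
noncomputable def convexPosCount (P : Finset (ℝ × ℝ)) (k : ℕ) : ℕ :=
  ((P.powersetCard k).filter fun S => ConvexPos S).card

/-- `mu k n` is the minimum number of `k`-element subsets in convex position over
all placements of `n` points in general position. -/
noncomputable def mu (k n : ℕ) : ℕ :=
  sInf {m | ∃ P : Finset (ℝ × ℝ), GenPos P ∧ P.card = n ∧ convexPosCount P k = m}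

/-- `x` is a γ-point of `T` if `T ∪ {x}` is in convex position. -/
def IsGammaPt (T : Finset (ℝ × ℝ)) (x : ℝ × ℝ) : Prop :=
  ConvexPos (insert x T)

/-- `x` is a β-point of `T` if `T ∪ {x}` is not in convex position and `x` does not
lie in the convex hull of `T`. -/
def IsBetaPt (T : Finset (ℝ × ℝ)) (x : ℝ × ℝ) : Prop :=
  ¬ ConvexPos (insert x T) ∧ x ∉ convexHull ℝ (T : Set (ℝ × ℝ))

open scoped Classical in
/-- `γ_T`: number of γ-points of `T` among the points of `P \ T`. -/
noncomputable def gammaCount (P T : Finset (ℝ × ℝ)) : ℕ :=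
  ((P \ T).filter fun x => IsGammaPt T x).card

open scoped Classical in
/-- `β_T`: number of β-points of `T` among the points of `P \ T`. -/
noncomputable def betaCount (P T : Finset (ℝ × ℝ)) : ℕ :=
  ((P \ T).filter fun x => IsBetaPt T x).card

open scoped Classical in
/-- Number of `k`-element subsets of `P` whose convex hull has exactly `j`
extreme points. -/
noncomputable def hullCount (P : Finset (ℝ × ℝ)) (k j : ℕ) : ℕ :=
  ((P.powersetCard k).filter fun S =>
    (Set.extremePoints ℝ (convexHull ℝ (S : Set (ℝ × ℝ)))).ncard = j).card

/-- `x` and `y` lie strictly on the same side of the line through `p` and `q`. -/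
def SameSide (p q x y : ℝ × ℝ) : Prop :=
  0 < ((q.1 - p.1) * (x.2 - p.2) - (q.2 - p.2) * (x.1 - p.1)) *
      ((q.1 - p.1) * (y.2 - p.2) - (q.2 - p.2) * (y.1 - p.1))

/-- `x` and `y` lie in the same region with respect to `T`: for each pair of
distinct points of `T`, they lie strictly on the same side of the line through them. -/
def SameRegion (T : Finset (ℝ × ℝ)) (x y : ℝ × ℝ) : Prop :=
  ∀ p ∈ T, ∀ q ∈ T, p ≠ q → SameSide p q x y

open scoped Classical in
/-- Number of 2-element subsets `{x, y}` of `P \ T` such that `x` and `y` are both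
γ-points of `T` lying in the same region with respect to `T`. -/
noncomputable def gammaSamePairs (P T : Finset (ℝ × ℝ)) : ℕ :=
  (((P \ T).powersetCard 2).filter fun S =>
    (∀ x ∈ S, IsGammaPt T x) ∧ ∀ x ∈ S, ∀ y ∈ S, x ≠ y → SameRegion T x y).card

open scoped Classical in
/-- Number of 2-element subsets `{x, y}` of `P \ T` such that `x` and `y` are both
γ-points of `T` lying in distinct regions with respect to `T`. -/
noncomputable def gammaDiffPairs (P T : Finset (ℝ × ℝ)) : ℕ :=
  (((P \ T).powersetCard 2).filter fun S =>
    (∀ x ∈ S, IsGammaPt T x) ∧ ∀ x ∈ S, ∀ y ∈ S, x ≠ y → ¬ SameRegion T x y).card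

open scoped Classical in
/-- Number of 2-element subsets `{x, y}` of `P \ T` such that `x` and `y` are both
β-points of `T` lying in the same region with respect to `T`. -/
noncomputable def betaSamePairs (P T : Finset (ℝ × ℝ)) : ℕ :=
  (((P \ T).powersetCard 2).filter fun S =>
    (∀ x ∈ S, IsBetaPt T x) ∧ ∀ x ∈ S, ∀ y ∈ S, x ≠ y → SameRegion T x y).card

open scoped Classical in
/-- Number of 2-element subsets `{x, y}` of `P \ T` such that `x` and `y` are both
β-points of `T` lying in distinct regions with respect to `T`. -/
noncomputable def betaDiffPairs (P T : Finset (ℝ × ℝ)) : ℕ :=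
  (((P \ T).powersetCard 2).filter fun S =>
    (∀ x ∈ S, IsBetaPt T x) ∧ ∀ x ∈ S, ∀ y ∈ S, x ≠ y → ¬ SameRegion T x y).card

/-- Twice the signed area of the triangle `p q r`. -/
def orient (p q r : ℝ × ℝ) : ℝ :=
  (q.1 - p.1) * (r.2 - p.2) - (q.2 - p.2) * (r.1 - p.1)

/-- Whether the triangle `p q r` is oriented counterclockwise. -/
noncomputable def ccw (p q r : ℝ × ℝ) : Bool := decide (0 < orient p q r)

lemma orient_ne_zero_of_not_collinear {x y z : ℝ × ℝ} (hxy : x ≠ y)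
    (h : ¬ Collinear ℝ ({x, y, z} : Set (ℝ × ℝ))) : orient x y z ≠ 0 := by
  intro h0
  apply h
  rw [collinear_iff_of_mem (p₀ := x) (by simp)]
  refine ⟨y - x, ?_⟩
  have hz : ∃ t : ℝ, z = t • (y - x) +ᵥ x := by
    unfold orient at h0
    by_cases h1 : y.1 - x.1 = 0
    · have h2 : y.2 - x.2 ≠ 0 := fun h2 => hxy (Prod.ext (by linarith) (by linarith))
      have h3 : z.1 - x.1 = 0 := by
        rw [h1, zero_mul, zero_sub, neg_eq_zero] at h0
        exact (mul_eq_zero.mp h0).resolve_left h2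
      refine ⟨(z.2 - x.2) / (y.2 - x.2), Prod.ext ?_ ?_⟩
      · simp [h1]; linarith
      · simp [h2]
    · refine ⟨(z.1 - x.1) / (y.1 - x.1), Prod.ext ?_ ?_⟩
      · simp [h1]
      · simp only [vadd_eq_add, Prod.snd_add, Prod.smul_snd, Prod.snd_sub, smul_eq_mul]
        field_simp
        linarith
  intro p hp
  simp only [Set.mem_insert_iff, Set.mem_singleton_iff] at hp
  rcases hp with rfl | rfl | rfl
  · exact ⟨0, by simp⟩
  · exact ⟨1, by simp⟩
  · exact hz

lemma mem_extremePoints_convexHull_insert {T : Finset (ℝ × ℝ)} {x : ℝ × ℝ} (hx : x ∉ T) :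
    x ∈ Set.extremePoints ℝ (convexHull ℝ (insert x T : Set (ℝ × ℝ))) ↔
      x ∉ convexHull ℝ (T : Set (ℝ × ℝ)) := by
  constructor
  · intro h hT
    rw [(convex_convexHull ℝ _).mem_extremePoints_iff_convex_sdiff] at h
    refine (convexHull_min ?_ h.2 hT).2 rfl
    intro t ht
    exact ⟨subset_convexHull ℝ _ (Set.mem_insert_of_mem _ ht), fun h' => hx (h' ▸ ht)⟩
  · intro h
    by_contra hne
    apply h
    have hfin : (insert x (T : Set (ℝ × ℝ))).Finite := T.finite_toSet.insert x
    have hKM := closure_convexHull_extremePoints (hfin.isCompact_convexHull ℝ) (convex_convexHull ℝ _)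
    have hsub : Set.extremePoints ℝ (convexHull ℝ (insert x T : Set (ℝ × ℝ))) ⊆ T := by
      intro y hy
      rcases extremePoints_convexHull_subset hy with rfl | h'
      · exact absurd hy hne
      · exact h'
    have hx' : x ∈ convexHull ℝ (insert x T : Set (ℝ × ℝ)) :=
      subset_convexHull ℝ _ (Set.mem_insert _ _)
    rw [← hKM] at hx'
    exact closure_minimal (convexHull_mono hsub) (T.finite_toSet.isClosed_convexHull ℝ) hx'

/-- Carathéodory theorem in the plane: a point of the hull lies in the hull of three points. -/
lemma exists_three_of_mem_convexHull {S : Finset (ℝ × ℝ)} (hS : 3 ≤ S.card) {x : ℝ × ℝ}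
    (hx : x ∈ convexHull ℝ (S : Set (ℝ × ℝ))) :
    ∃ T ∈ S.powersetCard 3, x ∈ convexHull ℝ (T : Set (ℝ × ℝ)) := by
  rw [convexHull_eq_union (𝕜 := ℝ)] at hx
  simp only [Set.mem_iUnion] at hx
  obtain ⟨t, htS, hind, hxt⟩ := hx
  have hcard : t.card ≤ 3 := by
    have h1 := hind.card_le_finrank_succ
    have h2 := Submodule.finrank_le (vectorSpan ℝ (Set.range ((↑) : t → ℝ × ℝ)))
    simp at h1 h2
    omega
  obtain ⟨T, htT, hTS, hT⟩ := Finset.exists_subsuperset_card_eq (by exact_mod_cast htS) hcard hS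
  exact ⟨T, Finset.mem_powersetCard.mpr ⟨hTS, hT⟩,
    convexHull_mono (by exact_mod_cast htT) hxt⟩

lemma ccw_eq_iff {p q r p' q' r' : ℝ × ℝ} (h : orient p q r ≠ 0) (h' : orient p' q' r' ≠ 0) :
    ccw p q r = ccw p' q' r' ↔ 0 < orient p q r * orient p' q' r' := by
  unfold ccw
  rcases h.lt_or_gt with h | h <;> rcases h'.lt_or_gt with h' | h'
  · simp [h.not_gt, h'.not_gt, mul_pos_of_neg_of_neg h h']
  · simp [h.not_gt, h', (mul_neg_of_neg_of_pos h h').not_gt]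
  · simp [h, h'.not_gt, (mul_neg_of_pos_of_neg h h').not_gt]
  · simp [h, h', mul_pos h h']

lemma ccw_swap_right {p q r : ℝ × ℝ} (h : orient p q r ≠ 0) : ccw p r q = !ccw p q r := by
  have e : orient p r q = -orient p q r := by unfold orient; ring
  unfold ccw
  rw [e]
  rcases h.lt_or_gt with h | h <;> simp [h, not_lt_of_gt]

lemma ccw_rotate (p q r : ℝ × ℝ) : ccw q r p = ccw p q r := by
  unfold ccw
  congr 2
  unfold orient
  ring

lemma mem_convexHull_triple_iff {a b c x : ℝ × ℝ} (h₁ : orient a b x ≠ 0)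
    (h₂ : orient b c x ≠ 0) (h₃ : orient a c x ≠ 0) :
    x ∈ convexHull ℝ ({a, b, c} : Set (ℝ × ℝ)) ↔
      ccw a b x = ccw b c x ∧ ccw b c x ≠ ccw a c x := by
  rw [Ne, ccw_eq_iff h₁ h₂, ccw_eq_iff h₂ h₃]
  constructor
  · rw [← convexJoin_segment_singleton, mem_convexJoin]
    rintro ⟨y, ⟨s, t, hs, ht, hst, rfl⟩, z, hz, ⟨u, v, hu, hv, huv, rfl⟩⟩
    obtain rfl : z = c := hz
    obtain rfl : s = 1 - t := by linarith
    obtain rfl : u = 1 - v := by linarith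
    have e₁ : orient a b ((1 - v) • ((1 - t) • a + t • b) + v • z) = v * orient a b z := by
      simp [orient]; ring
    have e₂ : orient b z ((1 - v) • ((1 - t) • a + t • b) + v • z) =
        ((1 - v) * (1 - t)) * orient a b z := by
      simp [orient]; ring
    have e₃ : orient a z ((1 - v) • ((1 - t) • a + t • b) + v • z) =
        -((1 - v) * t * orient a b z) := by
      simp [orient]; ring
    rw [e₁] at h₁ ⊢
    rw [e₂] at h₂ ⊢
    rw [e₃]
    have hD : 0 < orient a b z ^ 2 := by
      have : orient a b z ≠ 0 := right_ne_zero_of_mul h₁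
      positivity
    have hv' : 0 < v := lt_of_le_of_ne hv (left_ne_zero_of_mul h₁).symm
    have hA : 0 < (1 - v) * (1 - t) :=
      lt_of_le_of_ne (mul_nonneg hu hs) (left_ne_zero_of_mul h₂).symm
    have hB : 0 ≤ (1 - v) * t := mul_nonneg hu ht
    constructor
    · have := mul_pos (mul_pos hv' hA) hD
      linarith
    · have := mul_nonneg (mul_nonneg hA.le hB) hD.le
      linarith
  · rintro ⟨h12, h23⟩
    have key : ∀ α β γ : ℝ, 0 < α → 0 < β → 0 < γ →
        (α + β + γ) * x.1 = α * a.1 + β * b.1 + γ * c.1 →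
        (α + β + γ) * x.2 = α * a.2 + β * b.2 + γ * c.2 →
        x ∈ convexHull ℝ ({a, b, c} : Set (ℝ × ℝ)) := by
      intro α β γ hα hβ hγ e₁ e₂
      have hs : α + β + γ ≠ 0 := by positivity
      have hx : x = ∑ i, ![α / (α + β + γ), β / (α + β + γ), γ / (α + β + γ)] i • ![a, b, c] i := by
        rw [Fin.sum_univ_three]
        refine Prod.ext ?_ ?_
        · simp
          field_simp
          linarith
        · simp
          field_simp
          linarith
      rw [hx]
      refine (convex_convexHull ℝ _).sum_mem ?_ ?_ ?_
      · intro i _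
        fin_cases i <;> simp <;> positivity
      · rw [Fin.sum_univ_three]
        simp
        field_simp
      · intro i _
        apply subset_convexHull
        fin_cases i <;> simp
    have h13 : orient a c x * orient b c x < 0 := by
      refine lt_of_le_of_ne ?_ (mul_ne_zero h₃ h₂)
      rw [mul_comm]; exact not_lt.mp h23
    rcases h₂.lt_or_gt with h | h
    · have ha : orient a b x < 0 := by
        by_contra hc
        have := mul_nonpos_of_nonneg_of_nonpos (not_lt.mp hc) h.le
        linarith
      have hb : 0 < orient a c x := by
        by_contra hc
        have := mul_nonneg_of_nonpos_of_nonpos (not_lt.mp hc) h.le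
        linarith
      apply key (-orient b c x) (orient a c x) (-orient a b x) <;> try linarith
      all_goals unfold orient; ring
    · have ha : 0 < orient a b x := by
        by_contra hc
        have := mul_nonpos_of_nonpos_of_nonneg (not_lt.mp hc) h.le
        linarith
      have hb : orient a c x < 0 := by
        by_contra hc
        have := mul_nonneg (not_lt.mp hc) h.le
        linarith
      apply key (orient b c x) (-orient a c x) (orient a b x) <;> try linarith
      all_goals unfold orient; ring

/-- The signs of the terms of a vanishing alternating sum of four numbers do not all agree. -/
lemma ccw_acyclic {a b c d : ℝ × ℝ} (h₁ : orient a b c ≠ 0) (h₂ : orient a b d ≠ 0)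
    (h₃ : orient a c d ≠ 0) (h₄ : orient b c d ≠ 0) :
    ¬ (ccw a b c = ccw a c d ∧ ccw a b d = ccw b c d ∧ ccw a b c ≠ ccw a b d) := by
  have e : orient b c d - orient a c d + orient a b d - orient a b c = 0 := by
    unfold orient; ring
  unfold ccw
  rcases h₁.lt_or_gt with h₁ | h₁ <;> rcases h₂.lt_or_gt with h₂ | h₂ <;>
    rcases h₃.lt_or_gt with h₃ | h₃ <;> rcases h₄.lt_or_gt with h₄ | h₄ <;>
    simp [h₁, h₂, h₃, h₄, h₁.not_gt, h₂.not_gt, h₃.not_gt, h₄.not_gt] <;> linarith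

/-- The sign version of the three-term Grassmann–Plücker relation. -/
lemma ccw_grassmann_pluecker {a b c d e : ℝ × ℝ} (hbc : orient a b c ≠ 0)
    (hde : orient a d e ≠ 0) (hbd : orient a b d ≠ 0) (hce : orient a c e ≠ 0)
    (hbe : orient a b e ≠ 0) (hcd : orient a c d ≠ 0) :
    ¬ ((ccw a b c == ccw a d e) = (ccw a b e == ccw a c d) ∧
      (ccw a b c == ccw a d e) ≠ (ccw a b d == ccw a c e)) := by
  have e0 : orient a b c * orient a d e - orient a b d * orient a c e
      + orient a b e * orient a c d = 0 := by
    unfold orient; ring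
  have e₁ := mul_ne_zero hbc hde
  have e₂ := mul_ne_zero hbd hce
  have e₃ := mul_ne_zero hbe hcd
  simp only [Bool.beq_eq_decide_eq, ccw_eq_iff hbc hde, ccw_eq_iff hbd hce, ccw_eq_iff hbe hcd]
  rcases e₁.lt_or_gt with h₁ | h₁ <;> rcases e₂.lt_or_gt with h₂ | h₂ <;>
    rcases e₃.lt_or_gt with h₃ | h₃ <;>
    simp [h₁, h₂, h₃, h₁.not_gt, h₂.not_gt, h₃.not_gt] <;> linarith

/-! ### Sign patterns of five labelled points -/

/-- Point `x` lies in the triangle `a b c`, in terms of orientations. -/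
def signInside {ι : Type*} (χ : ι → ι → ι → Bool) (x a b c : ι) : Bool :=
  (χ a b x == χ b c x) && (χ b c x != χ a c x)

/-- Point `x` is extreme among `x, a, b, c, d`, in terms of orientations. -/
def signExtreme {ι : Type*} (χ : ι → ι → ι → Bool) (x a b c d : ι) : Bool :=
  !signInside χ x a b c && !signInside χ x a b d && !signInside χ x a c d && !signInside χ x b c d

/-- Points `x` and `y` are γ-points of `{a, b, c}` in the same region, in terms of orientations. -/
def signGood {ι : Type*} (χ : ι → ι → ι → Bool) (a b c x y : ι) : Bool :=
  !(χ a b c ^^ χ a b x ^^ χ a c x ^^ χ b c x) &&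
    (χ a b x == χ a b y) && (χ a c x == χ a c y) && (χ b c x == χ b c y)

set_option synthInstance.maxSize 4000 in
set_option synthInstance.maxHeartbeats 400000 in
lemma signGood_count (χ : Fin 5 → Fin 5 → Fin 5 → Bool)
    (hrot : ∀ i j k, χ j k i = χ i j k)
    (hswap : ∀ i j k, i < j → j < k → χ i k j = !χ i j k)
    (hacyc : ∀ a b c d, a < b → b < c → c < d →
      ¬ (χ a b c = χ a c d ∧ χ a b d = χ b c d ∧ χ a b c ≠ χ a b d))
    (hGP : ∀ a b c d e, [a, b, c, d, e].Nodup →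
      ¬ ((χ a b c == χ a d e) = (χ a b e == χ a c d) ∧
        (χ a b c == χ a d e) ≠ (χ a b d == χ a c e))) :
    (signGood χ 0 1 2 3 4).toNat + (signGood χ 0 1 3 2 4).toNat + (signGood χ 0 1 4 2 3).toNat +
    (signGood χ 0 2 3 1 4).toNat + (signGood χ 0 2 4 1 3).toNat + (signGood χ 0 3 4 1 2).toNat +
    (signGood χ 1 2 3 0 4).toNat + (signGood χ 1 2 4 0 3).toNat + (signGood χ 1 3 4 0 2).toNat +
    (signGood χ 2 3 4 0 1).toNat =
    let N := (signExtreme χ 0 1 2 3 4).toNat + (signExtreme χ 1 0 2 3 4).toNat +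
      (signExtreme χ 2 0 1 3 4).toNat + (signExtreme χ 3 0 1 2 4).toNat +
      (signExtreme χ 4 0 1 2 3).toNat
    5 * (if N = 5 then 1 else 0) + 2 * (if N = 4 then 1 else 0) := by
  have hswap' : ∀ i j k, i < j → j < k → χ j i k = !χ i j k := fun i j k h h' => by
    rw [← hswap i j k h h', ← hrot, ← hrot]
  have A1 := hacyc 0 1 2 3 (by decide) (by decide) (by decide)
  have A2 := hacyc 0 1 2 4 (by decide) (by decide) (by decide)
  have A3 := hacyc 0 1 3 4 (by decide) (by decide) (by decide)
  have A4 := hacyc 0 2 3 4 (by decide) (by decide) (by decide)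
  have A5 := hacyc 1 2 3 4 (by decide) (by decide) (by decide)
  have G1 := hGP 0 1 2 3 4 (by decide)
  have G2 := hGP 1 0 2 3 4 (by decide)
  have G3 := hGP 2 0 1 3 4 (by decide)
  have G4 := hGP 3 0 1 2 4 (by decide)
  have G5 := hGP 4 0 1 2 3 (by decide)
  have hrot' : ∀ i j k, χ k i j = χ i j k := fun i j k => (hrot k i j).symm
  simp (discharger := decide) only [signExtreme, signInside, signGood,
    hrot 0 1 2, hrot 0 1 3, hrot 0 1 4, hrot 0 2 3, hrot 0 2 4, hrot 0 3 4,
    hrot 1 2 3, hrot 1 2 4, hrot 1 3 4, hrot 2 3 4,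
    hswap 0 1 2, hswap 0 1 3, hswap 0 1 4, hswap 0 2 3, hswap 0 2 4, hswap 0 3 4,
    hswap 1 2 3, hswap 1 2 4, hswap 1 3 4, hswap 2 3 4,
    hswap' 0 1 2, hswap' 0 1 3, hswap' 0 1 4, hswap' 0 2 3, hswap' 0 2 4, hswap' 0 3 4,
    hswap' 1 2 3, hswap' 1 2 4, hswap' 1 3 4, hswap' 2 3 4,
    hrot' 0 1 2, hrot' 0 1 3, hrot' 0 1 4, hrot' 0 2 3, hrot' 0 2 4, hrot' 0 3 4,
    hrot' 1 2 3, hrot' 1 2 4, hrot' 1 3 4, hrot' 2 3 4] at A1 A2 A3 A4 A5 G1 G2 G3 G4 G5 ⊢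
  clear hswap' hrot' hrot hswap hacyc hGP
  generalize χ 0 1 2 = s012 at *
  generalize χ 0 1 3 = s013 at *
  generalize χ 0 1 4 = s014 at *
  generalize χ 0 2 3 = s023 at *
  generalize χ 0 2 4 = s024 at *
  generalize χ 0 3 4 = s034 at *
  generalize χ 1 2 3 = s123 at *
  generalize χ 1 2 4 = s124 at *
  generalize χ 1 3 4 = s134 at *
  generalize χ 2 3 4 = s234 at *
  clear χ
  revert A1 A2 A3 A4 A5 G1 G2 G3 G4 G5
  revert s012 s013 s014 s023 s024 s034 s123 s124 s134 s234
  decide +kernel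

/-! ### Five labelled points in the plane -/

lemma powersetCard_three_fin_five : (univ : Finset (Fin 5)).powersetCard 3 =
    {{0, 1, 2}, {0, 1, 3}, {0, 1, 4}, {0, 2, 3}, {0, 2, 4}, {0, 3, 4}, {1, 2, 3}, {1, 2, 4},
      {1, 3, 4}, {2, 3, 4}} := by
  decide

lemma convexPos_four_iff {a b c x : ℝ × ℝ} (habc : orient a b c ≠ 0) (habx : orient a b x ≠ 0)
    (hacx : orient a c x ≠ 0) (hbcx : orient b c x ≠ 0)
    (hne : [a, b, c, x].Nodup) :
    ConvexPos {x, a, b, c} ↔ (ccw a b c ^^ ccw a b x ^^ ccw a c x ^^ ccw b c x) = false := by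
  have ext_iff : ∀ p q r s : ℝ × ℝ, ({x, a, b, c} : Finset (ℝ × ℝ)) = {p, q, r, s} →
      p ∉ ({q, r, s} : Finset (ℝ × ℝ)) →
      (p ∈ Set.extremePoints ℝ (convexHull ℝ (({x, a, b, c} : Finset (ℝ × ℝ)) : Set (ℝ × ℝ))) ↔
        p ∉ convexHull ℝ ({q, r, s} : Set (ℝ × ℝ))) := by
    intro p q r s h hp
    rw [h, Finset.coe_insert, mem_extremePoints_convexHull_insert hp]
    simp
  simp only [List.nodup_cons, List.mem_cons, List.not_mem_nil, not_or] at hne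
  obtain ⟨⟨hab, hac, hax, -⟩, ⟨hbc, hbx, -⟩, ⟨hcx, -⟩, -⟩ := hne
  have swap : ∀ {p q r : ℝ × ℝ}, orient p q r ≠ 0 → orient p r q ≠ 0 := by
    intro p q r h h'
    apply h
    unfold orient at h' ⊢
    linarith
  have rot : ∀ {p q r : ℝ × ℝ}, orient p q r ≠ 0 → orient q r p ≠ 0 := by
    intro p q r h h'
    apply h
    unfold orient at h' ⊢
    linarith
  have hx := ext_iff x a b c rfl (by simp [Ne.symm hax, Ne.symm hbx, Ne.symm hcx])
  have ha := ext_iff a b c x (by ext; simp; tauto) (by simp [hab, hac, hax])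
  have hb := ext_iff b a c x (by ext; simp; tauto) (by simp [Ne.symm hab, hbc, hbx])
  have hc := ext_iff c a b x (by ext; simp; tauto) (by simp [Ne.symm hac, Ne.symm hbc, hcx])
  rw [mem_convexHull_triple_iff habx hbcx hacx] at hx
  rw [mem_convexHull_triple_iff (rot habc) (rot hacx) (rot habx), ccw_rotate a b c,
    ccw_rotate a c x, ccw_rotate a b x] at ha
  rw [mem_convexHull_triple_iff (swap habc) (rot hbcx) (swap habx), ccw_swap_right habc,
    ccw_rotate b c x, ccw_swap_right habx] at hb
  rw [mem_convexHull_triple_iff habc (swap hbcx) (swap hacx), ccw_swap_right hbcx,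
    ccw_swap_right hacx] at hc
  have hac := ccw_acyclic habc habx hacx hbcx
  simp only [ConvexPos, Finset.forall_mem_insert, Finset.mem_singleton, forall_eq, hx, ha, hb, hc]
  clear hx ha hb hc ext_iff swap rot
  generalize ccw a b c = s₁ at *
  generalize ccw a b x = s₂ at *
  generalize ccw a c x = s₃ at *
  generalize ccw b c x = s₄ at *
  revert hac
  revert s₁ s₂ s₃ s₄
  decide

/-- `x` and `y` are γ-points of `T` in the same region for any two distinct points of `D`. -/
def GammaSame (T D : Finset (ℝ × ℝ)) : Prop :=
  (∀ x ∈ D, IsGammaPt T x) ∧ ∀ x ∈ D, ∀ y ∈ D, x ≠ y → SameRegion T x y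

lemma sameSide_iff (p q x y : ℝ × ℝ) : SameSide p q x y ↔ 0 < orient p q x * orient p q y :=
  Iff.rfl

lemma sameRegion_triple_iff {a b c x y : ℝ × ℝ} (hne : [a, b, c].Nodup)
    (habx : orient a b x ≠ 0) (hacx : orient a c x ≠ 0) (hbcx : orient b c x ≠ 0)
    (haby : orient a b y ≠ 0) (hacy : orient a c y ≠ 0) (hbcy : orient b c y ≠ 0) :
    SameRegion {a, b, c} x y ↔
      ccw a b x = ccw a b y ∧ ccw a c x = ccw a c y ∧ ccw b c x = ccw b c y := by
  have swap : ∀ p q : ℝ × ℝ, SameSide q p x y ↔ SameSide p q x y := by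
    intro p q
    have e : ∀ z, orient q p z = -orient p q z := fun z => by unfold orient; ring
    rw [sameSide_iff, sameSide_iff, e, e, neg_mul_neg]
  rw [ccw_eq_iff habx haby, ccw_eq_iff hacx hacy, ccw_eq_iff hbcx hbcy,
    ← sameSide_iff, ← sameSide_iff, ← sameSide_iff]
  simp only [List.nodup_cons, List.mem_cons, List.not_mem_nil, not_or] at hne
  obtain ⟨⟨hab, hac, -⟩, ⟨hbc, -⟩, -⟩ := hne
  simp only [SameRegion, Finset.forall_mem_insert, Finset.mem_singleton, forall_eq]
  simp only [ne_eq, not_true, false_imp_iff, hab, hac, hbc, Ne.symm hab, Ne.symm hac, Ne.symm hbc,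
    not_false_iff, true_imp_iff, true_and, and_true, swap a b, swap a c, swap b c]
  tauto

section FivePoints

variable {p : Fin 5 → ℝ × ℝ}

lemma gammaSame_iff_signGood (hp : Function.Injective p)
    (h : ∀ i j k, [i, j, k].Nodup → orient (p i) (p j) (p k) ≠ 0) (i j k l m : Fin 5)
    (hd : [i, j, k, l, m].Nodup) :
    GammaSame {p i, p j, p k} {p l, p m} ↔
      signGood (fun i j k => ccw (p i) (p j) (p k)) i j k l m = true := by
  have hs := hd
  simp only [List.nodup_cons, List.mem_cons, List.not_mem_nil, not_or, not_false_iff, and_true,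
    List.nodup_nil] at hs h
  have nodup_triple : [p i, p j, p k].Nodup := by simp [hp.eq_iff]; tauto
  have nodup_left : [p i, p j, p k, p l].Nodup := by simp [hp.eq_iff]; tauto
  have nodup_right : [p i, p j, p k, p m].Nodup := by simp [hp.eq_iff]; tauto
  have hlm : p l ≠ p m := fun e => hs.2.2.2 (hp e)
  have comm : SameRegion {p i, p j, p k} (p m) (p l) ↔ SameRegion {p i, p j, p k} (p l) (p m) := by
    simp only [SameRegion, sameSide_iff, mul_comm]
  have e : GammaSame {p i, p j, p k} {p l, p m} ↔ (ConvexPos {p l, p i, p j, p k} ∧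
      ConvexPos {p m, p i, p j, p k}) ∧ SameRegion {p i, p j, p k} (p l) (p m) := by
    simp only [GammaSame, IsGammaPt, Finset.forall_mem_insert, Finset.mem_singleton, forall_eq,
      ne_eq, not_true, false_imp_iff, hlm, Ne.symm hlm, not_false_iff, true_imp_iff, true_and,
      and_true, comm, and_self]
  rw [e, convexPos_four_iff (h _ _ _ ?_) (h _ _ _ ?_) (h _ _ _ ?_) (h _ _ _ ?_) nodup_left,
    convexPos_four_iff (h _ _ _ ?_) (h _ _ _ ?_) (h _ _ _ ?_) (h _ _ _ ?_) nodup_right,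
    sameRegion_triple_iff nodup_triple (h _ _ _ ?_) (h _ _ _ ?_) (h _ _ _ ?_) (h _ _ _ ?_)
      (h _ _ _ ?_) (h _ _ _ ?_)]
  · simp only [signGood, Bool.and_eq_true, Bool.not_eq_true', beq_iff_eq]
    constructor
    · tauto
    · rintro ⟨⟨⟨h1, h2⟩, h3⟩, h4⟩
      exact ⟨⟨h1, by rw [← h2, ← h3, ← h4]; exact h1⟩, h2, h3, h4⟩
  all_goals tauto

lemma mem_convexHull_four_iff {a b c d x : ℝ × ℝ} (hne : [a, b, c, d].Nodup) :
    x ∈ convexHull ℝ ({a, b, c, d} : Set (ℝ × ℝ)) ↔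
      x ∈ convexHull ℝ ({a, b, c} : Set (ℝ × ℝ)) ∨ x ∈ convexHull ℝ ({a, b, d} : Set (ℝ × ℝ)) ∨
      x ∈ convexHull ℝ ({a, c, d} : Set (ℝ × ℝ)) ∨ x ∈ convexHull ℝ ({b, c, d} : Set (ℝ × ℝ)) := by
  constructor
  · intro hx
    have hcard : ({a, b, c, d} : Finset (ℝ × ℝ)).card = 4 := by
      have := List.toFinset_card_of_nodup hne
      simpa using this
    obtain ⟨T, hT, hxT⟩ := exists_three_of_mem_convexHull (S := {a, b, c, d}) (x := x)
      (by omega) (by simpa using hx)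
    rw [Finset.mem_powersetCard] at hT
    obtain ⟨y, hy, hyT⟩ := Finset.exists_mem_notMem_of_card_lt_card
      (s := T) (t := {a, b, c, d}) (by omega)
    have hsub : ∀ z ∈ T, z ≠ y ∧ (z = a ∨ z = b ∨ z = c ∨ z = d) := fun z hz =>
      ⟨fun e => hyT (e ▸ hz), by simpa using hT.1 hz⟩
    simp only [Finset.mem_insert, Finset.mem_singleton] at hy
    rcases hy with rfl | rfl | rfl | rfl
    · exact .inr <| .inr <| .inr <| convexHull_mono (fun z hz => by
        have := hsub z hz; simp; tauto) hxT
    · exact .inr <| .inr <| .inl <| convexHull_mono (fun z hz => by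
        have := hsub z hz; simp; tauto) hxT
    · exact .inr <| .inl <| convexHull_mono (fun z hz => by
        have := hsub z hz; simp; tauto) hxT
    · exact .inl <| convexHull_mono (fun z hz => by
        have := hsub z hz; simp; tauto) hxT
  · rintro (h | h | h | h)
    all_goals
      refine convexHull_mono ?_ h
      intro z
      simp only [Set.mem_insert_iff, Set.mem_singleton_iff]
      tauto

lemma mem_extremePoints_iff_signExtreme (hp : Function.Injective p)
    (h : ∀ i j k, [i, j, k].Nodup → orient (p i) (p j) (p k) ≠ 0) (i j k l m : Fin 5)
    (hd : [i, j, k, l, m].Nodup) {S : Finset (ℝ × ℝ)} (hS : S = {p i, p j, p k, p l, p m}) :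
    p i ∈ Set.extremePoints ℝ (convexHull ℝ (S : Set (ℝ × ℝ))) ↔
      signExtreme (fun i j k => ccw (p i) (p j) (p k)) i j k l m = true := by
  have hi : p i ∉ ({p j, p k, p l, p m} : Finset (ℝ × ℝ)) := by
    have := (hd.map hp)
    simpa using (List.nodup_cons.mp this).1
  have hi4 : [p j, p k, p l, p m].Nodup := (List.nodup_cons.mp hd).2.map hp
  rw [hS, Finset.coe_insert, mem_extremePoints_convexHull_insert hi]
  simp only [Finset.coe_insert, Finset.coe_singleton]
  rw [mem_convexHull_four_iff hi4]
  simp only [List.nodup_cons, List.mem_cons, List.not_mem_nil, not_or, not_false_iff, and_true,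
    List.nodup_nil] at hd h
  rw [mem_convexHull_triple_iff (h _ _ _ ?_) (h _ _ _ ?_) (h _ _ _ ?_),
    mem_convexHull_triple_iff (h _ _ _ ?_) (h _ _ _ ?_) (h _ _ _ ?_),
    mem_convexHull_triple_iff (h _ _ _ ?_) (h _ _ _ ?_) (h _ _ _ ?_),
    mem_convexHull_triple_iff (h _ _ _ ?_) (h _ _ _ ?_) (h _ _ _ ?_)]
  · simp only [signExtreme, signInside, Bool.and_eq_true, Bool.not_eq_true', Bool.and_eq_false_imp,
      beq_iff_eq, bne_eq_false_iff_eq]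
    tauto
  all_goals tauto

open scoped Classical in
lemma card_gammaSame_eq (hp : Function.Injective p)
    (h : ∀ i j k, [i, j, k].Nodup → orient (p i) (p j) (p k) ≠ 0)
    {S : Finset (ℝ × ℝ)} (hS : S = univ.map ⟨p, hp⟩) :
    ((S.powersetCard 3).filter fun T => GammaSame T (S \ T)).card =
      5 * (if (Set.extremePoints ℝ (convexHull ℝ (S : Set (ℝ × ℝ)))).ncard = 5 then 1 else 0) +
      2 * (if (Set.extremePoints ℝ (convexHull ℝ (S : Set (ℝ × ℝ)))).ncard = 4 then 1 else 0) := by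
  have hncard : (Set.extremePoints ℝ (convexHull ℝ (S : Set (ℝ × ℝ)))).ncard =
      ∑ i, if p i ∈ Set.extremePoints ℝ (convexHull ℝ (S : Set (ℝ × ℝ))) then 1 else 0 := by
    have e : Set.extremePoints ℝ (convexHull ℝ (S : Set (ℝ × ℝ))) =
        ((S.filter fun x => x ∈ Set.extremePoints ℝ (convexHull ℝ (S : Set (ℝ × ℝ))) :
          Finset (ℝ × ℝ)) : Set (ℝ × ℝ)) := by
      ext x
      simp only [Finset.coe_filter, Set.mem_ofPred_eq]
      exact ⟨fun hx => ⟨extremePoints_convexHull_subset hx, hx⟩, fun hx => hx.2⟩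
    conv_lhs => rw [e]
    rw [Set.ncard_coe_finset, Finset.card_filter]
    conv_lhs => rw [hS]
    rw [Finset.sum_map]
    simp [hS]
  have hcard : ((S.powersetCard 3).filter fun T => GammaSame T (S \ T)).card =
      ∑ I ∈ (univ : Finset (Fin 5)).powersetCard 3,
        if GammaSame (I.map ⟨p, hp⟩) (Iᶜ.map ⟨p, hp⟩) then 1 else 0 := by
    rw [Finset.card_filter, hS, Finset.powersetCard_map, Finset.sum_map]
    refine Finset.sum_congr rfl fun I _ => ?_
    simp only [RelEmbedding.coe_toEmbedding, Finset.mapEmbedding_apply, Finset.compl_eq_univ_sdiff,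
      Finset.map_sdiff]
    congr
  have toNat_ite : ∀ (q : Prop) (b : Bool), (q ↔ b = true) → (if q then 1 else 0) = b.toNat := by
    intro q b hq
    cases b <;> simp [hq]
  have hext : ∀ i j k l m : Fin 5, [i, j, k, l, m].Nodup → univ = ({i, j, k, l, m} : Finset (Fin 5)) →
      (if p i ∈ Set.extremePoints ℝ (convexHull ℝ (S : Set (ℝ × ℝ))) then 1 else 0) =
        (signExtreme (fun i j k => ccw (p i) (p j) (p k)) i j k l m).toNat :=
    fun i j k l m hd hu => toNat_ite _ _
      (mem_extremePoints_iff_signExtreme hp h i j k l m hd (by rw [hS, hu]; simp))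
  have hgood : ∀ i j k l m : Fin 5, [i, j, k, l, m].Nodup →
      ({i, j, k} : Finset (Fin 5))ᶜ = {l, m} →
      (if GammaSame (({i, j, k} : Finset (Fin 5)).map ⟨p, hp⟩)
        (({i, j, k} : Finset (Fin 5))ᶜ.map ⟨p, hp⟩) then 1 else 0) =
        (signGood (fun i j k => ccw (p i) (p j) (p k)) i j k l m).toNat := by
    intro i j k l m hd hc
    rw [hc]
    refine toNat_ite _ _ ?_
    rw [← gammaSame_iff_signGood hp h i j k l m hd]
    simp
  rw [hcard, hncard, Fin.sum_univ_five, powersetCard_three_fin_five]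
  repeat rw [Finset.sum_insert (by decide)]
  rw [Finset.sum_singleton, hext 0 1 2 3 4 (by decide) (by decide),
    hext 1 0 2 3 4 (by decide) (by decide), hext 2 0 1 3 4 (by decide) (by decide),
    hext 3 0 1 2 4 (by decide) (by decide), hext 4 0 1 2 3 (by decide) (by decide),
    hgood 0 1 2 3 4 (by decide) (by decide), hgood 0 1 3 2 4 (by decide) (by decide),
    hgood 0 1 4 2 3 (by decide) (by decide), hgood 0 2 3 1 4 (by decide) (by decide),
    hgood 0 2 4 1 3 (by decide) (by decide), hgood 0 3 4 1 2 (by decide) (by decide),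
    hgood 1 2 3 0 4 (by decide) (by decide), hgood 1 2 4 0 3 (by decide) (by decide),
    hgood 1 3 4 0 2 (by decide) (by decide), hgood 2 3 4 0 1 (by decide) (by decide)]
  have hlt : ∀ i j k : Fin 5, i < j → j < k → orient (p i) (p j) (p k) ≠ 0 := by
    intro i j k hij hjk
    apply h
    simp [hij.ne, hjk.ne, (hij.trans hjk).ne]
  have key := signGood_count (fun i j k => ccw (p i) (p j) (p k))
    (fun i j k => ccw_rotate _ _ _)
    (fun i j k hij hjk => ccw_swap_right (hlt i j k hij hjk))
    (fun a b c d hab hbc hcd => ccw_acyclic (hlt _ _ _ hab hbc) (hlt _ _ _ hab (hbc.trans hcd))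
      (hlt _ _ _ (hab.trans hbc) hcd) (hlt _ _ _ hbc hcd))
    (by
      intro a b c d e hd
      simp only [List.nodup_cons, List.mem_cons, List.not_mem_nil, not_or, not_false_iff, and_true,
        List.nodup_nil] at hd h
      apply ccw_grassmann_pluecker <;> apply h <;> tauto)
  rw [← key]
  ring

end FivePoints

open scoped Classical in
/-- Double counting of pairs `(T, D)` of disjoint subsets of sizes `a` and `b` by their union. -/
lemma sum_card_filter_powersetCard_sdiff {α : Type*} [DecidableEq α] (P : Finset α) (a b : ℕ)
    (Q : Finset α → Finset α → Prop) :
    ∑ T ∈ P.powersetCard a, (((P \ T).powersetCard b).filter (Q T)).card =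
      ∑ S ∈ P.powersetCard (a + b), ((S.powersetCard a).filter fun T => Q T (S \ T)).card := by
  rw [← Finset.card_sigma, ← Finset.card_sigma]
  refine Finset.card_nbij' (fun z => ⟨z.1 ∪ z.2, z.1⟩) (fun z => ⟨z.2, z.1 \ z.2⟩) ?_ ?_ ?_ ?_
  · rintro ⟨T, D⟩ hz
    simp only [Finset.coe_sigma, Set.mem_sigma_iff, Finset.mem_coe, Finset.mem_powersetCard,
      Finset.mem_filter, Finset.subset_sdiff] at hz ⊢
    obtain ⟨⟨hT, ha⟩, ⟨⟨hD, hdisj⟩, hb⟩, hQ⟩ := hz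
    refine ⟨⟨Finset.union_subset hT hD, ?_⟩, ⟨Finset.subset_union_left, ha⟩, ?_⟩
    · rw [Finset.card_union_of_disjoint hdisj.symm, ha, hb]
    · rwa [Finset.union_sdiff_cancel_left hdisj.symm]
  · rintro ⟨S, T⟩ hz
    simp only [Finset.coe_sigma, Set.mem_sigma_iff, Finset.mem_coe, Finset.mem_powersetCard,
      Finset.mem_filter] at hz ⊢
    obtain ⟨⟨hS, hab⟩, ⟨hT, ha⟩, hQ⟩ := hz
    refine ⟨⟨hT.trans hS, ha⟩, ⟨Finset.sdiff_subset_sdiff hS le_rfl, ?_⟩, hQ⟩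
    rw [Finset.card_sdiff_of_subset hT]
    omega
  · rintro ⟨T, D⟩ hz
    simp only [Finset.coe_sigma, Set.mem_sigma_iff, Finset.mem_coe, Finset.mem_powersetCard,
      Finset.mem_filter, Finset.subset_sdiff] at hz
    simp [Finset.union_sdiff_cancel_left hz.2.1.1.2.symm]
  · rintro ⟨S, T⟩ hz
    simp only [Finset.coe_sigma, Set.mem_sigma_iff, Finset.mem_coe, Finset.mem_powersetCard,
      Finset.mem_filter] at hz
    simp [Finset.union_sdiff_of_subset hz.2.1.1]

open scoped Classical in
/-- `hullCount` counts subsets coerced to `Set`; the coercion is injective, so it can be dropped. -/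
lemma hullCount_eq_sum (P : Finset (ℝ × ℝ)) (k j : ℕ) :
    hullCount P k j = ∑ S ∈ P.powersetCard k,
      if (Set.extremePoints ℝ (convexHull ℝ (S : Set (ℝ × ℝ)))).ncard = j then 1 else 0 := by
  have e : (do let a ← P.powersetCard k; pure (a : Set (ℝ × ℝ)) : Finset (Set (ℝ × ℝ))) =
      (P.powersetCard k).image (fun S : Finset (ℝ × ℝ) => (S : Set (ℝ × ℝ))) := by
    ext x
    simp [Finset.bind_def, Finset.pure_def, eq_comm]
  rw [hullCount, e, Finset.card_filter, Finset.sum_image fun _ _ _ _ h => Finset.coe_injective h]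

/-- The sum over 3-element subsets `T` of `P` of the number of pairs of γ-points of `T`
lying in the same region with respect to `T` equals `5·P₅(P) + 2·U(P)`. -/
theorem sum_gamma_same_region_pairs (P : Finset (ℝ × ℝ)) (n : ℕ) (hgp : GenPos P)
    (hcard : P.card = n) :
    ∑ T ∈ P.powersetCard 3, gammaSamePairs P T =
      5 * hullCount P 5 5 + 2 * hullCount P 5 4 := by
  classical
  have hcount := sum_card_filter_powersetCard_sdiff P 3 2 GammaSame
  have hleft : ∑ T ∈ P.powersetCard 3, gammaSamePairs P T =
      ∑ T ∈ P.powersetCard 3, (((P \ T).powersetCard 2).filter (GammaSame T)).card := by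
    refine Finset.sum_congr rfl fun T _ => ?_
    unfold gammaSamePairs GammaSame
    congr
  rw [hleft, hcount, hullCount_eq_sum, hullCount_eq_sum, Finset.mul_sum, Finset.mul_sum,
    ← Finset.sum_add_distrib]
  refine Finset.sum_congr rfl fun S hS => ?_
  rw [Finset.mem_powersetCard] at hS
  let e := (S.equivFinOfCardEq hS.2).symm
  have hinj : Function.Injective fun i => (e i : ℝ × ℝ) :=
    Subtype.val_injective.comp e.injective
  have hmem : ∀ i, (e i : ℝ × ℝ) ∈ P := fun i => hS.1 (e i).2
  have hmap : S = univ.map ⟨fun i => (e i : ℝ × ℝ), hinj⟩ := by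
    refine (Finset.eq_of_subset_of_card_le ?_ ?_).symm
    · intro x hx
      obtain ⟨i, -, rfl⟩ := Finset.mem_map.mp hx
      exact (e i).2
    · simp [hS.2]
  refine Eq.trans ?_ (card_gammaSame_eq hinj ?_ hmap)
  · congr
  · intro i j k hd
    simp only [List.nodup_cons, List.mem_cons, List.not_mem_nil, not_or, not_false_iff, and_true,
      List.nodup_nil] at hd
    have hij := hinj.ne hd.1.1
    exact orient_ne_zero_of_not_collinear hij (hgp _ (hmem i) _ (hmem j) _ (hmem k) hij
      (hinj.ne hd.1.2) (hinj.ne hd.2))
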